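/- Fix γ > 0 with γ ≠ 1, fix ε ∈ (0, 1) and y > 0, and set Y_N = y·N^{ε−1}. Then the exact mean density of imaginary parts satisfies the large deviation asymptotics lim_{N→∞} √N · e^{N·Φ_γ(Y_N)} · ρ_N^γ(Y_N) / Ψ_γ(Y_N) = 1. -/

import Mathlib

/-- The generalized Laguerre polynomial
`L_n^{(α)}(x) = Σ_{k=0}^n (−1)^k · binom(n+α, n−k) · x^k/k!`. -/
noncomputable def Lag (n α : ℕ) (x : ℝ) : ℝ :=
  ∑ k ∈ Finset.range (n + 1),
    (-1 : ℝ) ^ k * ((n + α).choose (n - k) : ℝ) * x ^ k / (Nat.factorial k : ℝ)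

/-- The exact mean density of the imaginary parts of the eigenvalues of the rank-one
non-Hermitian deformation `J = H + iγ·diag(1,0,…,0)` of the `N×N` GUE. -/
noncomputable def rhoIm (N : ℕ) (γ Y : ℝ) : ℝ :=
  (1 / (Y * γ)) * (1 - Y / γ) ^ (N - 2) * Real.exp (-(N : ℝ) * Y * (γ - Y)) *
    (((N : ℝ) - 1) / (N : ℝ) * (3 * Y - 2 * γ) * Lag (N - 1) 1 (-(N : ℝ) * Y ^ 2)
      + (2 * γ - 2 * Y + Y * (γ - Y) ^ 2) * Lag (N - 2) 1 (-(N : ℝ) * Y ^ 2))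

/-- `r_*(Y) = (√(Y²+4) − Y)/2`. -/
noncomputable def rstar (Y : ℝ) : ℝ := (Real.sqrt (Y ^ 2 + 4) - Y) / 2

/-- The large deviation rate function
`Φ_γ(Y) = Y(γ−Y) − log((γ−Y)/γ) − Y·r_*(Y) + 2·log r_*(Y)`. -/
noncomputable def Phi (γ Y : ℝ) : ℝ :=
  Y * (γ - Y) - Real.log ((γ - Y) / γ) - Y * rstar Y + 2 * Real.log (rstar Y)

/-- The pre-exponential factor
`Ψ_γ(Y) = (1/√(2π)) · (γ/(γ−Y)²) · (1 − r_*(Y)(γ−Y))² / (Y^{3/2}·(Y²+4)^{1/4})`. -/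
noncomputable def Psi (γ Y : ℝ) : ℝ :=
  (1 / Real.sqrt (2 * Real.pi)) * (γ / (γ - Y) ^ 2) *
    (1 - rstar Y * (γ - Y)) ^ 2 / (Y ^ ((3 : ℝ) / 2) * (Y ^ 2 + 4) ^ ((1 : ℝ) / 4))


/-- Contour integral representation of the Laguerre polynomials. -/
lemma lag_circ (n : ℕ) (c Y R : ℝ) (hR : 0 < R) :
    (∮ z in C(0, R), Complex.exp (c * z) * (1 + (Y : ℂ) / z) ^ (n + 1))
      = 2 * Real.pi * Complex.I * ((Y * Lag n 1 (-c * Y) : ℝ) : ℂ) := by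
  have hz0 : ∀ z ∈ Metric.sphere (0 : ℂ) R, z ≠ 0 := by
    intro z hz h
    simp [h] at hz
    exact hR.ne hz
  have h1 : (∮ z in C(0, R), Complex.exp (c * z) * (1 + (Y : ℂ) / z) ^ (n + 1))
      = ∮ z in C(0, R), ∑ j ∈ Finset.range (n + 2),
        (((n + 1).choose j : ℂ) * (Y : ℂ) ^ j) * ((1 / (z - 0) ^ j) • Complex.exp (c * z)) := by
    apply circleIntegral.integral_congr hR.le
    intro z hz
    simp only [smul_eq_mul, sub_zero]
    rw [add_comm (1 : ℂ), add_pow, Finset.mul_sum]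
    apply Finset.sum_congr rfl
    intro j _
    rw [div_pow]
    ring
  have hk : ∀ k : ℕ, (∮ z in C(0, R), (1 / (z - 0) ^ (k + 1)) • Complex.exp (c * z))
      = 2 * Real.pi * Complex.I / k.factorial * (c : ℂ) ^ k := by
    intro k
    have hd : Differentiable ℂ (fun z : ℂ => Complex.exp (c * z)) := by fun_prop
    have := DiffContOnCl.circleIntegral_one_div_sub_center_pow_smul (c := 0) (R := R) hR k
      (hd.diffContOnCl)
    rw [this, iteratedDeriv_cexp_const_mul]
    simp
  have h00 : (∮ z in C(0, R), (1 / (z - 0) ^ 0) • Complex.exp (c * z)) = 0 := by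
    have hd : Differentiable ℂ (fun z : ℂ => Complex.exp (c * z)) := by fun_prop
    have := Complex.circleIntegral_eq_zero_of_differentiable_on_off_countable (c := 0) hR.le
      Set.countable_empty hd.continuous.continuousOn (fun z _ => hd z)
    simpa using this
  rw [h1, circleIntegral.integral_fun_sum]
  · simp_rw [circleIntegral.integral_const_mul]
    rw [Finset.sum_range_succ', h00]
    simp_rw [hk]
    unfold Lag
    push_cast
    rw [mul_zero, add_zero, Finset.mul_sum, Finset.mul_sum]
    apply Finset.sum_congr rfl
    intro k hk'
    have hkn : k ≤ n := by simpa [Nat.lt_succ_iff] using hk'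
    have : (n + 1).choose (n - k) = (n + 1).choose (k + 1) := by
      rw [← Nat.choose_symm (by omega : k + 1 ≤ n + 1)]
      congr 1
      omega
    rw [this]
    have h2 : (-(c : ℂ) * Y) ^ k = (-1) ^ k * ((c : ℂ) ^ k * (Y : ℂ) ^ k) := by
      rw [← mul_pow, ← mul_pow]; congr 1; ring
    have h3 : ((-1 : ℂ) ^ k) * (-1) ^ k = 1 := by
      rw [← mul_pow]; simp
    rw [h2]
    linear_combination (-(2 * Real.pi * Complex.I * ((n + 1).choose (k + 1) : ℂ) * Y * (Y:ℂ) ^ k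
      * (c : ℂ) ^ k / k.factorial)) * h3
  · intro j _
    apply ContinuousOn.circleIntegrable hR.le
    apply ContinuousOn.mul continuousOn_const
    simp only [smul_eq_mul]
    apply ContinuousOn.mul
    · apply ContinuousOn.div continuousOn_const (by fun_prop)
      intro z hz
      have := hz0 z hz
      simpa using fun h => absurd h this
    · fun_prop

lemma rstar_pos (Y : ℝ) : 0 < rstar Y := by
  unfold rstar
  have : Y < Real.sqrt (Y ^ 2 + 4) := by
    apply Real.lt_sqrt_of_sq_lt; linarith
  linarith

lemma rstar_eq (Y : ℝ) : rstar Y * (rstar Y + Y) = 1 := by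
  unfold rstar
  have := Real.sq_sqrt (by positivity : (0:ℝ) ≤ Y ^ 2 + 4)
  nlinarith

/-- The normalised integrand of the steepest descent analysis. -/
noncomputable def kern (N : ℕ) (γ Y θ : ℝ) : ℂ :=
  Complex.exp ((N * (rstar Y * Y) : ℝ) * (Complex.exp (θ * Complex.I) - 1)) *
    (1 + (rstar Y * Y : ℝ) * (Complex.exp (-(θ * Complex.I)) - 1)) ^ (N - 1) *
    Complex.exp (θ * Complex.I) *
    (((1 - rstar Y * (γ - Y)) ^ 2 : ℝ) +
      (((N : ℝ) - 1) / N * (3 * Y - 2 * γ) * rstar Y : ℝ) * (Complex.exp (-(θ * Complex.I)) - 1)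
      - ((3 * Y - 2 * γ) / (N * Y) : ℝ))

lemma kern_periodic (N : ℕ) (γ Y : ℝ) : Function.Periodic (kern N γ Y) (2 * Real.pi) := by
  intro θ
  have h1 : Complex.exp (((θ + 2 * Real.pi : ℝ) : ℂ) * Complex.I)
      = Complex.exp (θ * Complex.I) := by
    push_cast
    rw [add_mul, Complex.exp_add, Complex.exp_two_pi_mul_I, mul_one]
  unfold kern
  simp only [Complex.exp_neg, h1]

lemma exact_formula (N : ℕ) (hN : 2 ≤ N) (γ Y : ℝ) (hY : 0 < Y) :
    (((((N : ℝ) - 1) / (N : ℝ) * (3 * Y - 2 * γ) * Lag (N - 1) 1 (-(N : ℝ) * Y ^ 2)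
      + (2 * γ - 2 * Y + Y * (γ - Y) ^ 2) * Lag (N - 2) 1 (-(N : ℝ) * Y ^ 2) : ℝ)) : ℂ)
    = ((1 / (2 * Real.pi) * rstar Y * ((rstar Y)⁻¹ ^ 2) ^ N * Real.exp (N * Y * rstar Y) : ℝ) : ℂ)
      * ∫ θ in (-Real.pi)..Real.pi, kern N γ Y θ := by
  obtain ⟨M, rfl⟩ : ∃ M, N = M + 2 := ⟨N - 2, by omega⟩
  set r := rstar Y with hr
  have hr0 : 0 < r := rstar_pos Y
  have hre : r * (r + Y) = 1 := rstar_eq Y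
  set A' : ℝ := (((M + 2 : ℕ) : ℝ) - 1) / ((M + 2 : ℕ) : ℝ) * (3 * Y - 2 * γ) with hA'
  set B : ℝ := 2 * γ - 2 * Y + Y * (γ - Y) ^ 2 with hB
  set c : ℝ := ((M + 2 : ℕ) : ℝ) * Y with hc
  have l1 := lag_circ (M + 1) c Y r hr0
  have l2 := lag_circ M c Y r hr0
  have e0 : -c * Y = -((M + 2 : ℕ) : ℝ) * Y ^ 2 := by rw [hc]; ring
  rw [e0] at l1 l2
  have hz0 : ∀ z ∈ Metric.sphere (0 : ℂ) r, z ≠ 0 := by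
    intro z hz h
    simp [h] at hz
    exact hr0.ne hz
  have hci : ∀ n : ℕ, CircleIntegrable
      (fun z => Complex.exp (c * z) * (1 + (Y : ℂ) / z) ^ n) 0 r := by
    intro n
    apply ContinuousOn.circleIntegrable hr0.le
    apply ContinuousOn.mul (by fun_prop)
    apply ContinuousOn.pow
    apply ContinuousOn.add continuousOn_const
    exact ContinuousOn.div continuousOn_const continuousOn_id hz0
  have l3 : (∮ z in C(0, r), ((A' : ℂ) * (Complex.exp (c * z) * (1 + (Y : ℂ) / z) ^ (M + 1 + 1))
      + (B : ℂ) * (Complex.exp (c * z) * (1 + (Y : ℂ) / z) ^ (M + 1))))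
      = 2 * Real.pi * Complex.I * (Y : ℂ) *
        ((A' * Lag (M + 1) 1 (-((M + 2 : ℕ) : ℝ) * Y ^ 2)
          + B * Lag M 1 (-((M + 2 : ℕ) : ℝ) * Y ^ 2) : ℝ) : ℂ) := by
    rw [circleIntegral.integral_add]
    · rw [circleIntegral.integral_const_mul, circleIntegral.integral_const_mul, l1, l2]
      push_cast; ring
    · exact (hci (M + 1 + 1)).const_smul (a := (A' : ℂ))
    · exact (hci (M + 1)).const_smul (a := (B : ℂ))
  have key : ∀ θ : ℝ, deriv (circleMap 0 r) θ •
      ((A' : ℂ) * (Complex.exp (c * circleMap 0 r θ) * (1 + (Y : ℂ) / circleMap 0 r θ) ^ (M + 1 + 1))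
      + (B : ℂ) * (Complex.exp (c * circleMap 0 r θ) * (1 + (Y : ℂ) / circleMap 0 r θ) ^ (M + 1)))
      = (Complex.I * Y * (r * ((r)⁻¹ ^ 2) ^ (M + 2) * Real.exp (((M + 2 : ℕ) : ℝ) * Y * r) : ℝ))
        * kern (M + 2) γ Y θ := by
    intro θ
    rw [deriv_circleMap]
    have hcm : circleMap 0 r θ = r * Complex.exp (θ * Complex.I) := by simp [circleMap]
    rw [hcm]
    unfold kern
    rw [← hr]
    rw [Complex.exp_neg]
    set u := Complex.exp (θ * Complex.I) with hu
    have hu0 : u ≠ 0 := Complex.exp_ne_zero _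
    have hrc : (r : ℂ) ≠ 0 := by exact_mod_cast hr0.ne'
    have hrec : (r : ℂ) * (r + Y) = 1 := by exact_mod_cast hre
    have hYc : (Y : ℂ) ≠ 0 := by exact_mod_cast hY.ne'
    have hMc : ((M : ℂ) + 2) ≠ 0 := by exact_mod_cast (by positivity : ((M : ℝ) + 2) ≠ 0)
    have e1 : 1 + (Y : ℂ) / (r * u) = (r : ℂ)⁻¹ ^ 2 * (1 + ((r * Y : ℝ) : ℂ) * (u⁻¹ - 1)) := by
      push_cast
      field_simp
      linear_combination (u) * hrec
    have e2 : Complex.exp (c * (r * u)) = (Real.exp (((M + 2 : ℕ) : ℝ) * Y * r) : ℝ) *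
        Complex.exp ((((M + 2 : ℕ) : ℝ) * (r * Y) : ℝ) * (u - 1)) := by
      rw [Complex.ofReal_exp, ← Complex.exp_add, hc]
      congr 1; push_cast; ring
    rw [e1, e2]
    set w := 1 + ((r * Y : ℝ) : ℂ) * (u⁻¹ - 1) with hw
    have e3 : (A' : ℂ) * w + B * r ^ 2 = Y * (((1 - r * (γ - Y)) ^ 2 : ℝ) +
      ((((M + 2 : ℕ) : ℝ) - 1) / ((M + 2 : ℕ) : ℝ) * (3 * Y - 2 * γ) * r : ℝ) * (u⁻¹ - 1)
      - ((3 * Y - 2 * γ) / (((M + 2 : ℕ) : ℝ) * Y) : ℝ)) := by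
      rw [← hA', hw]
      have : (A' : ℂ) = (3 * Y - 2 * γ) - (3 * Y - 2 * γ) / (M + 2) := by
        rw [hA']; push_cast; field_simp; try ring
      have h2 : (Y : ℂ) * ((3 * Y - 2 * γ) / ((M + 2) * Y)) = (3 * Y - 2 * γ) / (M + 2) := by
        field_simp
      push_cast
      rw [hB]
      push_cast
      linear_combination this + h2 + 2 * (γ - Y : ℂ) * hrec
    have e4 : (M + 2 - 1 : ℕ) = M + 1 := by omega
    rw [e4]
    generalize Complex.exp ((((M + 2 : ℕ) : ℝ) * (r * Y) : ℝ) * (u - 1)) = E1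
    have e5 : (((r * (r⁻¹ ^ 2) ^ (M + 2) * Real.exp (((M + 2 : ℕ) : ℝ) * Y * r)) : ℝ) : ℂ)
       = r * ((r : ℂ)⁻¹ ^ 2) ^ (M + 2) * (Real.exp (((M + 2 : ℕ) : ℝ) * Y * r) : ℝ) := by
      push_cast; ring
    rw [e5]
    generalize ((Real.exp (((M + 2 : ℕ) : ℝ) * Y * r) : ℝ) : ℂ) = E2
    have e6 : (r : ℂ)⁻¹ ^ 2 * r ^ 2 = 1 := by field_simp
    generalize hX : (((1 - r * (γ - Y)) ^ 2 : ℝ) : ℂ) +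
      ((((M + 2 : ℕ) : ℝ) - 1) / ((M + 2 : ℕ) : ℝ) * (3 * Y - 2 * γ) * r : ℝ) * (u⁻¹ - 1)
      - ((3 * Y - 2 * γ) / (((M + 2 : ℕ) : ℝ) * Y) : ℝ) = X at e3 ⊢
    simp only [smul_eq_mul]
    generalize (r : ℂ)⁻¹ ^ 2 = s at e6 ⊢
    clear_value w
    linear_combination (r * u * Complex.I * E1 * E2 * s ^ (M + 2) * w ^ (M + 1)) * e3
      - (r * u * Complex.I * E1 * E2 * s ^ (M + 1) * w ^ (M + 1) * B) * e6
  have l4 : (∮ z in C(0, r), ((A' : ℂ) * (Complex.exp (c * z) * (1 + (Y : ℂ) / z) ^ (M + 1 + 1))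
      + (B : ℂ) * (Complex.exp (c * z) * (1 + (Y : ℂ) / z) ^ (M + 1))))
      = (Complex.I * Y * (r * ((r)⁻¹ ^ 2) ^ (M + 2) * Real.exp (((M + 2 : ℕ) : ℝ) * Y * r) : ℝ))
        * ∫ θ in (-Real.pi)..Real.pi, kern (M + 2) γ Y θ := by
    unfold circleIntegral
    simp_rw [key]
    rw [intervalIntegral.integral_const_mul]
    congr 1
    have := (kern_periodic (M + 2) γ Y).intervalIntegral_add_eq 0 (-Real.pi)
    rw [zero_add] at this
    rw [this]
    congr 1; ring
  rw [l3] at l4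
  have hYc : (Y : ℂ) ≠ 0 := by exact_mod_cast hY.ne'
  have hpi : (Real.pi : ℂ) ≠ 0 := by exact_mod_cast Real.pi_ne_zero
  have hcan : (2 * Real.pi * Complex.I * (Y : ℂ)) ≠ 0 := by simp [hYc, hpi]
  apply mul_left_cancel₀ hcan
  have e7 : M + 2 - 1 = M + 1 := by omega
  have e8 : M + 2 - 2 = M := by omega
  rw [e7, e8, l4]
  have e9 : (((1 / (2 * Real.pi) * r * (r⁻¹ ^ 2) ^ (M + 2)
      * Real.exp (((M + 2 : ℕ) : ℝ) * Y * r)) : ℝ) : ℂ)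
      = 1 / (2 * Real.pi) * ((r * (r⁻¹ ^ 2) ^ (M + 2)
      * Real.exp (((M + 2 : ℕ) : ℝ) * Y * r) : ℝ) : ℂ) := by
    push_cast; ring
  rw [e9]
  field_simp

lemma pow_sub_pow_bound (x y : ℂ) (hx : ‖x‖ ≤ 1) (hy : ‖y‖ ≤ 1) (n : ℕ) :
    ‖x ^ n - y ^ n‖ ≤ n * ‖x - y‖ := by
  induction n with
  | zero => simp
  | succ k ih =>
    have e : x ^ (k + 1) - y ^ (k + 1) = x ^ k * (x - y) + (x ^ k - y ^ k) * y := by ring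
    rw [e]
    have h1 : ‖x ^ k * (x - y)‖ ≤ 1 * ‖x - y‖ := by
      rw [norm_mul, norm_pow]
      gcongr
      exact pow_le_one₀ (norm_nonneg _) hx
    have h2 : ‖(x ^ k - y ^ k) * y‖ ≤ (k * ‖x - y‖) * 1 := by
      rw [norm_mul]
      gcongr
    calc _ ≤ _ := norm_add_le _ _
      _ ≤ 1 * ‖x - y‖ + (k * ‖x - y‖) * 1 := add_le_add h1 h2
      _ = _ := by push_cast; ring

lemma rstar_le_one {Y : ℝ} (hY : 0 ≤ Y) : rstar Y ≤ 1 := by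
  have h1 := rstar_pos Y
  have h2 := rstar_eq Y
  nlinarith

lemma rstar_ge_half {Y : ℝ} (hY : Y ≤ 1) : 1 / 2 ≤ rstar Y := by
  unfold rstar
  have : 2 ≤ Real.sqrt (Y ^ 2 + 4) := by
    apply Real.le_sqrt_of_sq_le; nlinarith [sq_nonneg Y]
  linarith

lemma rstar_mul_le_one (Y : ℝ) : rstar Y * Y ≤ 1 := by
  have h2 := rstar_eq Y
  nlinarith [sq_nonneg (rstar Y)]

lemma norm_exp_neg (θ : ℝ) : ‖Complex.exp (-(θ * Complex.I))‖ = 1 := by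
  have := Complex.norm_exp_ofReal_mul_I (-θ)
  rw [← this]; congr 2; push_cast; ring

lemma norm_one_add_le (a θ : ℝ) (ha : 0 ≤ a) (ha1 : a ≤ 1) :
    ‖1 + (a : ℂ) * (Complex.exp (-(θ * Complex.I)) - 1)‖ ≤ 1 := by
  have e : 1 + (a : ℂ) * (Complex.exp (-(θ * Complex.I)) - 1)
    = ((1 - a : ℝ) : ℂ) + (a : ℂ) * Complex.exp (-(θ * Complex.I)) := by push_cast; ring
  rw [e]
  calc _ ≤ ‖((1 - a : ℝ) : ℂ)‖ + ‖(a : ℂ) * Complex.exp (-(θ * Complex.I))‖ := norm_add_le _ _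
    _ = (1 - a) + a := by
      rw [norm_mul, norm_exp_neg, Complex.norm_real, Complex.norm_real, Real.norm_eq_abs,
        Real.norm_eq_abs, abs_of_nonneg ha, abs_of_nonneg (by linarith), mul_one]
    _ = 1 := by ring

lemma norm_exp_phase (c θ : ℝ) :
    ‖Complex.exp ((c : ℂ) * (Complex.exp (θ * Complex.I) - 1))‖
      = Real.exp (-(c * (1 - Real.cos θ))) := by
  rw [Complex.norm_exp]
  congr 1
  rw [Complex.re_ofReal_mul, Complex.sub_re, Complex.exp_ofReal_mul_I_re, Complex.one_re]
  ring

lemma norm_exp_sub_le (θ : ℝ) : ‖Complex.exp (-(θ * Complex.I)) - 1‖ ≤ |θ| := by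
  have := Real.norm_exp_I_mul_ofReal_sub_one_le (x := -θ)
  simp only [Real.norm_eq_abs, abs_neg] at this
  refine le_trans (le_of_eq ?_) this
  congr 3; push_cast; ring

lemma norm_exp_sub_le_two (θ : ℝ) : ‖Complex.exp (-(θ * Complex.I)) - 1‖ ≤ 2 := by
  calc _ ≤ ‖Complex.exp (-(θ * Complex.I))‖ + ‖(1 : ℂ)‖ := norm_sub_le _ _
    _ = 2 := by rw [norm_exp_neg]; norm_num

lemma kern_bound (N : ℕ) (hN : 2 ≤ N) (γ Y θ : ℝ) (hγ : 0 < γ) (hY : 0 < Y) (hY1 : Y ≤ 1)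
    (hNY : 1 ≤ N * Y) (hθ : |θ| ≤ Real.pi) :
    ‖kern N γ Y θ‖ ≤ Real.exp (-(1 / Real.pi ^ 2) * (N * Y * θ ^ 2))
      * ((2 + γ) ^ 2 + 3 * (3 + 2 * γ)) := by
  have hr0 := rstar_pos Y
  have hr1 := rstar_le_one hY.le
  have hr2 := rstar_ge_half hY1
  have ha := rstar_mul_le_one Y
  have ha0 : 0 ≤ rstar Y * Y := by positivity
  have hN0 : (0 : ℝ) < N := by
    have : 0 < N := by omega
    exact_mod_cast this
  have hN1 : (1 : ℝ) ≤ N := by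
    have : 1 ≤ N := by omega
    exact_mod_cast this
  unfold kern
  rw [norm_mul, norm_mul, norm_mul, Complex.norm_exp_ofReal_mul_I, norm_exp_phase, norm_pow, mul_one]
  have hcos := Real.cos_le_one_sub_mul_cos_sq hθ
  have b1 : Real.exp (-(N * (rstar Y * Y) * (1 - Real.cos θ)))
      ≤ Real.exp (-(1 / Real.pi ^ 2) * (N * Y * θ ^ 2)) := by
    apply Real.exp_le_exp.mpr
    have h1 : 2 / Real.pi ^ 2 * θ ^ 2 ≤ 1 - Real.cos θ := by linarith
    have h2 : N * (1 / 2 * Y) * (2 / Real.pi ^ 2 * θ ^ 2)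
        ≤ N * (rstar Y * Y) * (1 - Real.cos θ) := by gcongr
    have h3 : N * (1 / 2 * Y) * (2 / Real.pi ^ 2 * θ ^ 2)
      = (1 / Real.pi ^ 2) * (N * Y * θ ^ 2) := by ring
    linarith
  have b2 : ‖1 + ((rstar Y * Y : ℝ) : ℂ) * (Complex.exp (-(θ * Complex.I)) - 1)‖ ^ (N - 1) ≤ 1 :=
    pow_le_one₀ (norm_nonneg _) (norm_one_add_le _ _ ha0 ha)
  have hA : |3 * Y - 2 * γ| ≤ 3 + 2 * γ := by
    rw [abs_le]; constructor <;> linarith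
  have b3 : ‖(((1 - rstar Y * (γ - Y)) ^ 2 : ℝ) : ℂ)‖ ≤ (2 + γ) ^ 2 := by
    rw [Complex.norm_real, Real.norm_eq_abs, abs_pow]
    have : |1 - rstar Y * (γ - Y)| ≤ 2 + γ := by
      rw [abs_le]; constructor <;> nlinarith
    gcongr
  have b4 : ‖(((((N : ℝ) - 1) / N * (3 * Y - 2 * γ) * rstar Y : ℝ) : ℂ))
      * (Complex.exp (-(θ * Complex.I)) - 1)‖ ≤ (3 + 2 * γ) * 2 := by
    rw [norm_mul]
    have : ‖((((N : ℝ) - 1) / N * (3 * Y - 2 * γ) * rstar Y : ℝ) : ℂ)‖ ≤ 1 * (3 + 2 * γ) * 1 := by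
      rw [Complex.norm_real, Real.norm_eq_abs, abs_mul, abs_mul]
      have h1 : |((N : ℝ) - 1) / N| ≤ 1 := by
        rw [abs_of_nonneg (div_nonneg (by linarith) hN0.le), div_le_one hN0]; linarith
      have h2 : |rstar Y| ≤ 1 := by rw [abs_of_pos hr0]; exact hr1
      gcongr
    have h2 := norm_exp_sub_le_two θ
    calc _ ≤ (1 * (3 + 2 * γ) * 1) * 2 := by gcongr
      _ = _ := by ring
  have b5 : ‖(((3 * Y - 2 * γ) / (N * Y) : ℝ) : ℂ)‖ ≤ 3 + 2 * γ := by
    rw [Complex.norm_real, Real.norm_eq_abs, abs_div, abs_of_pos (by positivity : 0 < N * Y)]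
    exact (div_le_self (abs_nonneg _) hNY).trans hA
  have b6 : ‖(((1 - rstar Y * (γ - Y)) ^ 2 : ℝ) : ℂ) +
      (((N : ℝ) - 1) / N * (3 * Y - 2 * γ) * rstar Y : ℝ) * (Complex.exp (-(θ * Complex.I)) - 1)
      - ((3 * Y - 2 * γ) / (N * Y) : ℝ)‖ ≤ (2 + γ) ^ 2 + 3 * (3 + 2 * γ) := by
    refine (norm_sub_le _ _).trans ?_
    have := norm_add_le (((1 - rstar Y * (γ - Y)) ^ 2 : ℝ) : ℂ)
      ((((N : ℝ) - 1) / N * (3 * Y - 2 * γ) * rstar Y : ℝ) * (Complex.exp (-(θ * Complex.I)) - 1))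
    linarith
  calc _ ≤ Real.exp (-(1 / Real.pi ^ 2) * (N * Y * θ ^ 2)) * 1
        * ((2 + γ) ^ 2 + 3 * (3 + 2 * γ)) := by gcongr
    _ = _ := by ring

lemma rstar_continuous : Continuous rstar := by
  unfold rstar; fun_prop

lemma rstar_zero : rstar 0 = 1 := by
  unfold rstar
  have : Real.sqrt 4 = 2 := by
    rw [show (4 : ℝ) = 2 ^ 2 by norm_num]; exact Real.sqrt_sq (by norm_num)
  norm_num [this]

section limits
open Filter Topology

lemma kern_pointwise (γ : ℝ) (Y : ℕ → ℝ) (hpos : ∀ᶠ N in atTop, 0 < Y N)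
    (hY0 : Tendsto Y atTop (𝓝 0)) (hNY : Tendsto (fun N : ℕ => (N : ℝ) * Y N) atTop atTop)
    (s : ℝ) :
    Tendsto (fun N : ℕ => kern N γ (Y N) (s / Real.sqrt (N * Y N))) atTop
      (𝓝 ((Real.exp (-1 * s ^ 2) * (1 - γ) ^ 2 : ℝ) : ℂ)) := by
  set θ : ℕ → ℝ := fun N => s / Real.sqrt (N * Y N) with hθ
  have hθ0 : Tendsto θ atTop (𝓝 0) :=
    Tendsto.div_atTop tendsto_const_nhds (Real.tendsto_sqrt_atTop.comp hNY)
  have hr : Tendsto (fun N => rstar (Y N)) atTop (𝓝 1) := by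
    have := (rstar_continuous.tendsto 0).comp hY0
    rwa [rstar_zero] at this
  have hθc : Tendsto (fun N => (θ N : ℂ)) atTop (𝓝 0) := by
    have := (Complex.continuous_ofReal.tendsto 0).comp hθ0
    simpa [Function.comp_def] using this
  have hu : Tendsto (fun N => Complex.exp (θ N * Complex.I)) atTop (𝓝 1) := by
    have := (Complex.continuous_exp.tendsto (0 * Complex.I)).comp (hθc.mul_const Complex.I)
    simpa [Function.comp_def] using this
  have hv : Tendsto (fun N => Complex.exp (-(θ N * Complex.I)) - 1) atTop (𝓝 0) := by
    have := (Complex.continuous_exp.tendsto (-(0 * Complex.I))).comp (hθc.mul_const Complex.I).neg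
    have := this.sub_const 1
    simpa [Function.comp_def] using this
  have hw : Tendsto (fun N => ((rstar (Y N) * Y N : ℝ) : ℂ) *
      (Complex.exp (-(θ N * Complex.I)) - 1)) atTop (𝓝 0) := by
    have h1 : Tendsto (fun N => ((rstar (Y N) * Y N : ℝ) : ℂ)) atTop (𝓝 ((1 * 0 : ℝ) : ℂ)) :=
      (Complex.continuous_ofReal.tendsto _).comp (hr.mul hY0)
    simpa using h1.mul hv
  -- the main exponential
  have hmain : Tendsto (fun N : ℕ =>
      Complex.exp ((N * (rstar (Y N) * Y N) : ℝ) * (Complex.exp (θ N * Complex.I) - 1)) *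
      Complex.exp (((rstar (Y N) * Y N : ℝ) : ℂ) *
      (Complex.exp (-(θ N * Complex.I)) - 1)) ^ (N - 1)) atTop
      (𝓝 ((Real.exp (-1 * s ^ 2) : ℝ) : ℂ)) := by
    have hsinc : Tendsto (fun N : ℕ => -(rstar (Y N) * (s ^ 2 * Real.sinc (θ N / 2) ^ 2))) atTop
        (𝓝 (-1 * s ^ 2)) := by
      have h2 : Tendsto (fun N => Real.sinc (θ N / 2)) atTop (𝓝 1) := by
        have := (Real.continuous_sinc.tendsto (0 / 2)).comp (hθ0.div_const 2)
        simpa [Function.comp_def] using this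
      have := (hr.mul ((h2.pow 2).const_mul (s ^ 2))).neg
      simpa [Function.comp_def] using this
    have hc := (Complex.continuous_ofReal.tendsto _).comp hsinc
    have hfull := (Complex.continuous_exp.tendsto _).comp (hc.sub hw)
    rw [sub_zero, ← Complex.ofReal_exp] at hfull
    refine hfull.congr' ?_
    filter_upwards [hpos, eventually_ge_atTop 2] with N hYN hN
    have hN0 : (0 : ℝ) < N := by
      have : 0 < N := by omega
      exact_mod_cast this
    simp only [Function.comp]
    rw [← Complex.exp_nat_mul, ← Complex.exp_add]
    congr 1
    have ht : 0 < (N : ℝ) * Y N := by positivity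
    have hs : (N : ℝ) * Y N * (2 - 2 * Real.cos (θ N)) = s ^ 2 * Real.sinc (θ N / 2) ^ 2 := by
      have h1 : Real.sin (θ N / 2) = θ N / 2 * Real.sinc (θ N / 2) := by
        by_cases h : θ N / 2 = 0
        · simp [h]
        · rw [Real.sinc_of_ne_zero h, mul_comm, div_mul_cancel₀ _ h]
      have h2 : Real.cos (θ N) = 1 - 2 * Real.sin (θ N / 2) ^ 2 := by
        have := Real.cos_sq' (θ N / 2)
        have h3 := Real.cos_two_mul (θ N / 2)
        rw [show 2 * (θ N / 2) = θ N by ring] at h3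
        linarith
      have h4 : (N : ℝ) * Y N * θ N ^ 2 = s ^ 2 := by
        simp only [hθ]
        rw [div_pow, Real.sq_sqrt ht.le]; field_simp
      rw [h2, h1]
      linear_combination (Real.sinc (θ N / 2) ^ 2) * h4
    have hcosc : (Complex.exp (θ N * Complex.I) + Complex.exp (-(θ N * Complex.I)))
        = 2 * ((Real.cos (θ N) : ℝ) : ℂ) := by
      rw [Complex.ofReal_cos, Complex.cos]
      rw [show -(θ N : ℂ) * Complex.I = -(θ N * Complex.I) by ring]
      ring
    have hsc : ((N : ℂ)) * (Y N : ℂ) * (2 - 2 * (Real.cos (θ N) : ℝ))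
       = (s : ℂ) ^ 2 * (Real.sinc (θ N / 2) : ℝ) ^ 2 := by exact_mod_cast hs
    have hN1 : ((N - 1 : ℕ) : ℂ) = (N : ℂ) - 1 := by
      rw [Nat.cast_sub (by omega)]; simp
    rw [hN1]
    push_cast
    push_cast at hsc hcosc
    linear_combination (rstar (Y N) : ℂ) * hsc - (N * rstar (Y N) * Y N : ℂ) * hcosc
  -- the error
  have herr : Tendsto (fun N : ℕ =>
      Complex.exp ((N * (rstar (Y N) * Y N) : ℝ) * (Complex.exp (θ N * Complex.I) - 1)) *
      ((1 + ((rstar (Y N) * Y N : ℝ) : ℂ) *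
      (Complex.exp (-(θ N * Complex.I)) - 1)) ^ (N - 1) - Complex.exp (((rstar (Y N) * Y N : ℝ) : ℂ) *
      (Complex.exp (-(θ N * Complex.I)) - 1)) ^ (N - 1))) atTop (𝓝 0) := by
    have hz : Tendsto (fun N => Y N * s ^ 2) atTop (𝓝 0) := by
      simpa using hY0.mul_const (s ^ 2)
    refine squeeze_zero_norm' ?_ hz
    have hw1 : ∀ᶠ N in atTop, ‖((rstar (Y N) * Y N : ℝ) : ℂ) *
      (Complex.exp (-(θ N * Complex.I)) - 1)‖ ≤ 1 := by
      have := hw.norm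
      rw [norm_zero] at this
      exact this.eventually_le_const (by norm_num)
    filter_upwards [hpos, eventually_ge_atTop 2, hw1] with N hYN hN hwN
    have hN0 : (0 : ℝ) < N := by
      have : 0 < N := by omega
      exact_mod_cast this
    have ht : 0 < (N : ℝ) * Y N := by positivity
    have h4 : (N : ℝ) * Y N * θ N ^ 2 = s ^ 2 := by
      simp only [hθ]
      rw [div_pow, Real.sq_sqrt ht.le]; field_simp
    have hr0 := rstar_pos (Y N)
    have hr1 := rstar_le_one hYN.le
    have ha := rstar_mul_le_one (Y N)
    have ha0 : 0 ≤ rstar (Y N) * Y N := by positivity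
    rw [norm_mul, norm_exp_phase]
    have c1 : Real.exp (-(N * (rstar (Y N) * Y N) * (1 - Real.cos (θ N)))) ≤ 1 := by
      apply Real.exp_le_one_iff.mpr
      have : 0 ≤ 1 - Real.cos (θ N) := by linarith [Real.cos_le_one (θ N)]
      have : 0 ≤ N * (rstar (Y N) * Y N) * (1 - Real.cos (θ N)) := by positivity
      linarith
    set w := ((rstar (Y N) * Y N : ℝ) : ℂ) * (Complex.exp (-(θ N * Complex.I)) - 1) with hwdef
    have c2 : ‖1 + w‖ ≤ 1 := norm_one_add_le _ _ ha0 ha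
    have c3 : ‖Complex.exp w‖ ≤ 1 := by
      have := norm_exp_phase (rstar (Y N) * Y N) (-θ N)
      rw [Complex.ofReal_neg, neg_mul] at this
      rw [hwdef, this]
      apply Real.exp_le_one_iff.mpr
      have : 0 ≤ 1 - Real.cos (-θ N) := by linarith [Real.cos_le_one (-θ N)]
      have : 0 ≤ (rstar (Y N) * Y N) * (1 - Real.cos (-θ N)) := by positivity
      linarith
    have c4 := pow_sub_pow_bound _ _ c2 c3 (N - 1)
    have c5 : ‖1 + w - Complex.exp w‖ ≤ ‖w‖ ^ 2 := by
      have := Complex.norm_exp_sub_one_sub_id_le hwN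
      rw [← norm_neg] at this
      refine le_trans (le_of_eq ?_) this
      congr 1; ring
    have c6 : ‖w‖ ≤ Y N * |θ N| := by
      rw [hwdef, norm_mul, Complex.norm_real, Real.norm_eq_abs, abs_of_nonneg ha0]
      have := norm_exp_sub_le (θ N)
      have h2 : rstar (Y N) * Y N ≤ 1 * Y N := by gcongr
      rw [one_mul] at h2
      gcongr
    have hN1 : ((N - 1 : ℕ) : ℝ) ≤ N := by exact_mod_cast Nat.sub_le N 1
    calc _ ≤ 1 * (((N - 1 : ℕ) : ℝ) * ‖1 + w - Complex.exp w‖) := by gcongr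
      _ ≤ 1 * ((N : ℝ) * (Y N * |θ N|) ^ 2) := by
        gcongr
        exact c5.trans (by gcongr)
      _ = Y N * s ^ 2 := by
        rw [mul_pow, sq_abs, ← h4]; ring
  have hF : Tendsto (fun N : ℕ =>
      Complex.exp ((N * (rstar (Y N) * Y N) : ℝ) * (Complex.exp (θ N * Complex.I) - 1)) *
      (1 + ((rstar (Y N) * Y N : ℝ) : ℂ) *
      (Complex.exp (-(θ N * Complex.I)) - 1)) ^ (N - 1)) atTop
      (𝓝 ((Real.exp (-1 * s ^ 2) : ℝ) : ℂ)) := by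
    have := herr.add hmain
    rw [zero_add] at this
    refine this.congr fun N => ?_
    ring
  have hG : Tendsto (fun N : ℕ => (((1 - rstar (Y N) * (γ - Y N)) ^ 2 : ℝ) : ℂ) +
      (((N : ℝ) - 1) / N * (3 * Y N - 2 * γ) * rstar (Y N) : ℝ)
        * (Complex.exp (-(θ N * Complex.I)) - 1)
      - ((3 * Y N - 2 * γ) / (N * Y N) : ℝ)) atTop (𝓝 (((1 - γ) ^ 2 : ℝ) : ℂ)) := by
    have g1 : Tendsto (fun N : ℕ => (1 - rstar (Y N) * (γ - Y N)) ^ 2) atTop (𝓝 ((1 - γ) ^ 2)) := by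
      have := (((hr.mul (hY0.const_sub γ)).const_sub 1).pow 2)
      simpa [Function.comp_def] using this
    have gA : Tendsto (fun N : ℕ => 3 * Y N - 2 * γ) atTop (𝓝 (- (2 * γ))) := by
      have := (hY0.const_mul 3).sub_const (2 * γ)
      simpa [Function.comp_def] using this
    have g2 : Tendsto (fun N : ℕ => ((N : ℝ) - 1) / N * (3 * Y N - 2 * γ) * rstar (Y N)) atTop
        (𝓝 (1 * (- (2 * γ)) * 1)) := by
      have h1 : Tendsto (fun N : ℕ => ((N : ℝ) - 1) / N) atTop (𝓝 1) := by
        have := (tendsto_inv_atTop_zero.comp (tendsto_natCast_atTop_atTop (R := ℝ))).const_sub 1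
        rw [sub_zero] at this
        refine this.congr' ?_
        filter_upwards [eventually_ge_atTop 1] with N hN
        have hN0 : (N : ℝ) ≠ 0 := by
          have : N ≠ 0 := by omega
          exact_mod_cast this
        simp only [Function.comp]
        field_simp
      exact (h1.mul gA).mul hr
    have g3 : Tendsto (fun N : ℕ => (3 * Y N - 2 * γ) / (N * Y N)) atTop (𝓝 0) :=
      gA.div_atTop hNY
    have k1 := (Complex.continuous_ofReal.tendsto _).comp g1
    have k2 := (Complex.continuous_ofReal.tendsto _).comp g2
    have k3 := (Complex.continuous_ofReal.tendsto _).comp g3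
    have := (k1.add (k2.mul hv)).sub k3
    rw [mul_zero, add_zero, Complex.ofReal_zero, sub_zero] at this
    exact this
  have := (hF.mul hu).mul hG
  rw [mul_one, ← Complex.ofReal_mul] at this
  exact this

lemma kern_cont (N : ℕ) (γ Y : ℝ) : Continuous (kern N γ Y) := by
  unfold kern; fun_prop

lemma kern_integral (γ : ℝ) (hγ : 0 < γ) (Y : ℕ → ℝ) (hpos : ∀ᶠ N in atTop, 0 < Y N)
    (hY0 : Tendsto Y atTop (𝓝 0)) (hNY : Tendsto (fun N : ℕ => (N : ℝ) * Y N) atTop atTop) :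
    Tendsto (fun N : ℕ => (Real.sqrt (N * Y N) : ℂ) *
      ∫ θ in (-Real.pi)..Real.pi, kern N γ (Y N) θ) atTop
      (𝓝 ((Real.sqrt Real.pi * (1 - γ) ^ 2 : ℝ) : ℂ)) := by
  set S : ℕ → Set ℝ := fun N =>
    Set.Ioc (-Real.pi * Real.sqrt (N * Y N)) (Real.pi * Real.sqrt (N * Y N)) with hS
  have hsq : Tendsto (fun N : ℕ => Real.sqrt (N * Y N)) atTop atTop :=
    Real.tendsto_sqrt_atTop.comp hNY
  have hD : Tendsto (fun N : ℕ => ∫ s, (S N).indicator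
      (fun s => kern N γ (Y N) (s / Real.sqrt (N * Y N))) s) atTop
      (𝓝 (∫ s : ℝ, ((Real.exp (-1 * s ^ 2) * (1 - γ) ^ 2 : ℝ) : ℂ))) := by
    apply MeasureTheory.tendsto_integral_filter_of_dominated_convergence
      (fun s => Real.exp (-(1 / Real.pi ^ 2) * s ^ 2) * ((2 + γ) ^ 2 + 3 * (3 + 2 * γ)))
    · filter_upwards with N
      apply MeasureTheory.AEStronglyMeasurable.indicator _ measurableSet_Ioc
      exact ((kern_cont N γ (Y N)).comp (continuous_id.div_const _)).aestronglyMeasurable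
    · filter_upwards [hpos, eventually_ge_atTop 2, hY0.eventually_le_const (show (0:ℝ) < 1 by norm_num),
        hNY.eventually_ge_atTop 1] with N h1 h2 h3 h4
      filter_upwards with s
      have hq : 0 < Real.sqrt (N * Y N) := Real.sqrt_pos.mpr (by linarith)
      by_cases hs : s ∈ S N
      · rw [Set.indicator_of_mem hs]
        have hab : |s / Real.sqrt (N * Y N)| ≤ Real.pi := by
          rw [abs_div, abs_of_pos hq, div_le_iff₀ hq, abs_le]
          constructor <;> [linarith [hs.1]; exact hs.2]
        have := kern_bound N h2 γ (Y N) _ hγ h1 h3 h4 hab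
        have e : (N : ℝ) * Y N * (s / Real.sqrt (N * Y N)) ^ 2 = s ^ 2 := by
          rw [div_pow, Real.sq_sqrt (by linarith)]
          field_simp
        rwa [e] at this
      · rw [Set.indicator_of_notMem hs, norm_zero]
        positivity
    · exact (integrable_exp_neg_mul_sq (by positivity)).mul_const _
    · filter_upwards with s
      refine (kern_pointwise γ Y hpos hY0 hNY s).congr' ?_
      have h1 : ∀ᶠ N in atTop, |s| + 1 ≤ Real.pi * Real.sqrt (N * Y N) :=
        (hsq.const_mul_atTop Real.pi_pos).eventually_ge_atTop _
      filter_upwards [h1] with N hN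
      rw [Set.indicator_of_mem]
      constructor
      · have := neg_abs_le s; linarith
      · have := le_abs_self s; linarith
  have hval : (∫ s : ℝ, ((Real.exp (-1 * s ^ 2) * (1 - γ) ^ 2 : ℝ) : ℂ))
      = ((Real.sqrt Real.pi * (1 - γ) ^ 2 : ℝ) : ℂ) := by
    rw [integral_complex_ofReal, MeasureTheory.integral_mul_const, integral_gaussian, div_one]
  rw [hval] at hD
  refine hD.congr' ?_
  filter_upwards [hNY.eventually_ge_atTop 1] with N h4
  have hq : 0 < Real.sqrt (N * Y N) := Real.sqrt_pos.mpr (by linarith)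
  rw [MeasureTheory.integral_indicator measurableSet_Ioc,
    ← intervalIntegral.integral_of_le (by nlinarith [Real.pi_pos]),
    intervalIntegral.integral_comp_div _ hq.ne']
  rw [mul_div_cancel_right₀ _ hq.ne', mul_div_cancel_right₀ _ hq.ne']
  rfl

end limits

lemma exp_Phi (N : ℕ) (γ Y : ℝ) (hγ : 0 < γ) (hYγ : Y < γ) :
    Real.exp ((N : ℝ) * Phi γ Y) = Real.exp (N * Y * (γ - Y)) * (((γ - Y) / γ) ^ N)⁻¹ *
      (Real.exp (N * Y * rstar Y))⁻¹ * (rstar Y ^ 2) ^ N := by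
  have h1 : 0 < (γ - Y) / γ := div_pos (by linarith) hγ
  have h2 : 0 < rstar Y ^ 2 := pow_pos (rstar_pos Y) 2
  have e1 : ((γ - Y) / γ) ^ N = Real.exp (N * Real.log ((γ - Y) / γ)) := by
    rw [Real.exp_nat_mul, Real.exp_log h1]
  have e2 : (rstar Y ^ 2) ^ N = Real.exp (N * (2 * Real.log (rstar Y))) := by
    rw [Real.exp_nat_mul, ← Real.exp_log h2, Real.log_pow]; norm_num
  rw [e1, e2, ← Real.exp_neg, ← Real.exp_neg, ← Real.exp_add, ← Real.exp_add, ← Real.exp_add]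
  congr 1
  unfold Phi
  ring

lemma ratio_formula (N : ℕ) (hN : 2 ≤ N) (γ Y : ℝ) (hγ : 0 < γ) (hY : 0 < Y) (hYγ : Y < γ)
    (hq : 1 - rstar Y * (γ - Y) ≠ 0) :
    Real.sqrt N * Real.exp ((N : ℝ) * Phi γ Y) * rhoIm N γ Y / Psi γ Y
    = (rstar Y * (Y ^ 2 + 4) ^ ((1 : ℝ) / 4) * Real.sqrt (2 * Real.pi) / (2 * Real.pi)
        / (1 - rstar Y * (γ - Y)) ^ 2)
      * ((Real.sqrt (N * Y) : ℂ) * ∫ θ in (-Real.pi)..Real.pi, kern N γ Y θ).re := by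
  have hex := congrArg Complex.re (exact_formula N hN γ Y hY)
  rw [Complex.ofReal_re, Complex.re_ofReal_mul] at hex
  rw [Complex.re_ofReal_mul]
  have hN0 : (0 : ℝ) < N := by
    have : 0 < N := by omega
    exact_mod_cast this
  unfold rhoIm Psi
  rw [hex, exp_Phi N γ Y hγ hYγ]
  generalize (∫ θ in (-Real.pi)..Real.pi, kern N γ Y θ).re = J
  have hr0 := rstar_pos Y
  set r := rstar Y
  have hE : Real.exp (-(N : ℝ) * Y * (γ - Y)) = (Real.exp (N * Y * (γ - Y)))⁻¹ := by
    rw [← Real.exp_neg]; congr 1; ring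
  rw [hE]
  have hE1 := Real.exp_pos (N * Y * (γ - Y))
  have hE2 := Real.exp_pos (N * Y * r)
  generalize Real.exp (N * Y * (γ - Y)) = E1 at hE1 ⊢
  generalize Real.exp (N * Y * r) = E2 at hE2 ⊢
  have hg : γ - Y ≠ 0 := by linarith
  have hY32 : Y ^ ((3 : ℝ) / 2) = Y * Real.sqrt Y := by
    rw [Real.sqrt_eq_rpow, show (3 : ℝ) / 2 = 1 + 1 / 2 by norm_num, Real.rpow_add hY, Real.rpow_one]
  have hsq : Real.sqrt (N * Y) = Real.sqrt N * Real.sqrt Y := Real.sqrt_mul hN0.le _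
  rw [hY32, hsq]
  have hsY : 0 < Real.sqrt Y := Real.sqrt_pos.mpr hY
  have hs2 : 0 < Real.sqrt (2 * Real.pi) := Real.sqrt_pos.mpr (by positivity)
  have hQ : 0 < (Y ^ 2 + 4) ^ ((1 : ℝ) / 4) := by positivity
  generalize (Y ^ 2 + 4) ^ ((1 : ℝ) / 4) = Q at hQ ⊢
  have hpow : (1 - Y / γ) ^ (N - 2) * (((γ - Y) / γ) ^ N)⁻¹ = (γ / (γ - Y)) ^ 2 := by
    have e : 1 - Y / γ = (γ - Y) / γ := by field_simp
    have e2 : ((γ - Y) / γ) ^ N = ((γ - Y) / γ) ^ (N - 2) * ((γ - Y) / γ) ^ 2 := by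
      rw [← pow_add]; congr 1; omega
    have h0 : ((γ - Y) / γ) ≠ 0 := div_ne_zero hg hγ.ne'
    rw [e, e2, mul_inv, ← mul_assoc, mul_inv_cancel₀ (pow_ne_zero _ h0), one_mul, ← inv_pow, inv_div]
  have hrr : (r ^ 2) ^ N * (r⁻¹ ^ 2) ^ N = 1 := by
    rw [← mul_pow]
    have : r ^ 2 * r⁻¹ ^ 2 = 1 := by field_simp
    rw [this, one_pow]
  generalize (1 - Y / γ) ^ (N - 2) = P1 at hpow ⊢
  generalize (((γ - Y) / γ) ^ N)⁻¹ = P2 at hpow ⊢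
  generalize (r ^ 2) ^ N = R1 at hrr ⊢
  generalize (r⁻¹ ^ 2) ^ N = R2 at hrr ⊢
  have hsq2 : Real.sqrt Y * Real.sqrt Y = Y := Real.mul_self_sqrt hY.le
  have step : Real.sqrt N * (E1 * P2 * E2⁻¹ * R1) *
      (1 / (Y * γ) * P1 * E1⁻¹ * (1 / (2 * Real.pi) * r * R2 * E2 * J))
      = (P1 * P2) * (R1 * R2) * (Real.sqrt N * r * J / (Y * γ * (2 * Real.pi))) := by
    field_simp
  rw [step, hpow, hrr]
  have hpi := Real.pi_pos
  generalize 1 - r * (γ - Y) = q at hq ⊢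
  field_simp

open Filter Topology in
lemma general_limit (γ : ℝ) (hγ : 0 < γ) (hγ1 : γ ≠ 1) (Y : ℕ → ℝ) (hpos : ∀ᶠ N in atTop, 0 < Y N)
    (hY0 : Tendsto Y atTop (𝓝 0)) (hNY : Tendsto (fun N : ℕ => (N : ℝ) * Y N) atTop atTop) :
    Tendsto (fun N : ℕ => Real.sqrt N * Real.exp ((N : ℝ) * Phi γ (Y N)) * rhoIm N γ (Y N)
      / Psi γ (Y N)) atTop (𝓝 1) := by
  have hI := (Complex.continuous_re.tendsto _).comp (kern_integral γ hγ Y hpos hY0 hNY)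
  rw [Complex.ofReal_re] at hI
  have hr : Tendsto (fun N => rstar (Y N)) atTop (𝓝 1) := by
    have := (rstar_continuous.tendsto 0).comp hY0
    rwa [rstar_zero] at this
  have hq : Tendsto (fun N => 1 - rstar (Y N) * (γ - Y N)) atTop (𝓝 (1 - γ)) := by
    have := (hr.mul (hY0.const_sub γ)).const_sub 1
    simpa using this
  have hg0 : 1 - γ ≠ 0 := fun h => hγ1 (by linarith)
  have hQ : Tendsto (fun N => ((Y N) ^ 2 + 4) ^ ((1 : ℝ) / 4)) atTop (𝓝 (Real.sqrt 2)) := by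
    have h1 : Tendsto (fun N => (Y N) ^ 2 + 4) atTop (𝓝 (0 ^ 2 + 4)) := (hY0.pow 2).add_const 4
    have h2 := h1.rpow_const (p := (1 : ℝ) / 4) (Or.inl (by norm_num))
    have h3 : ((0 : ℝ) ^ 2 + 4) ^ ((1 : ℝ) / 4) = Real.sqrt 2 := by
      rw [Real.sqrt_eq_rpow, show (0 : ℝ) ^ 2 + 4 = 2 ^ (2 : ℝ) by norm_num,
        ← Real.rpow_mul (by norm_num)]
      norm_num
    rwa [h3] at h2
  have hlim := ((((hr.mul hQ).mul_const (Real.sqrt (2 * Real.pi))).div_const (2 * Real.pi)).div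
    (hq.pow 2) (pow_ne_zero 2 hg0)).mul hI
  have hval : 1 * Real.sqrt 2 * Real.sqrt (2 * Real.pi) / (2 * Real.pi) / (1 - γ) ^ 2
      * (Real.sqrt Real.pi * (1 - γ) ^ 2) = 1 := by
    have hpi := Real.pi_pos
    have e1 : Real.sqrt (2 * Real.pi) = Real.sqrt 2 * Real.sqrt Real.pi :=
      Real.sqrt_mul (by norm_num) _
    have e2 : Real.sqrt 2 * Real.sqrt 2 = 2 := Real.mul_self_sqrt (by norm_num)
    have e3 : Real.sqrt Real.pi * Real.sqrt Real.pi = Real.pi := Real.mul_self_sqrt hpi.le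
    rw [e1]
    field_simp
    rw [← pow_two] at e2 e3
    rw [e2, e3]
  rw [hval] at hlim
  refine hlim.congr' ?_
  filter_upwards [hpos, eventually_ge_atTop 2, hY0.eventually_lt_const hγ,
    hq.eventually_ne hg0] with N h1 h2 h3 h4
  exact (ratio_formula N h2 γ (Y N) hγ h1 h3 h4).symm

/-- For fixed `γ > 0`, `γ ≠ 1`, `ε ∈ (0,1)` and `y > 0`, with
`Y_N = y·N^{ε−1}`, the mean density of imaginary parts satisfies
`lim_{N→∞} √N · e^{NΦ_γ(Y_N)} · ρ_N^γ(Y_N) / Ψ_γ(Y_N) = 1`. -/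
theorem large_deviation_asymptotics_scaled_Y (γ ε y : ℝ) (hγ : 0 < γ) (hγ1 : γ ≠ 1)
    (hε0 : 0 < ε) (hε1 : ε < 1) (hy : 0 < y) :
    Filter.Tendsto
      (fun N : ℕ =>
        Real.sqrt N * Real.exp ((N : ℝ) * Phi γ (y * (N : ℝ) ^ (ε - 1)))
            * rhoIm N γ (y * (N : ℝ) ^ (ε - 1))
          / Psi γ (y * (N : ℝ) ^ (ε - 1)))
      Filter.atTop (nhds 1) := by
  have hNr := tendsto_natCast_atTop_atTop (R := ℝ)
  apply general_limit γ hγ hγ1 (fun N : ℕ => y * (N : ℝ) ^ (ε - 1))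
  · filter_upwards [Filter.eventually_ge_atTop 1] with N hN
    have : (0 : ℝ) < N := by
      have : 0 < N := by omega
      exact_mod_cast this
    positivity
  · have h := (tendsto_rpow_neg_atTop (by linarith : 0 < 1 - ε)).comp hNr
    have h2 := h.const_mul y
    rw [mul_zero] at h2
    refine h2.congr fun N => ?_
    simp only [Function.comp]
    congr 2; ring
  · have h := ((tendsto_rpow_atTop hε0).comp hNr).const_mul_atTop hy
    refine h.congr' ?_
    filter_upwards [Filter.eventually_ge_atTop 1] with N hN
    have hN0 : (0 : ℝ) < N := by
      have : 0 < N := by omega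
      exact_mod_cast this
    simp only [Function.comp]
    rw [Real.rpow_sub_one hN0.ne']
    field_simp
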